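/- arXiv:2510.05595 — 2 statements merged into one kernel-verified Lean document; each statement's English description precedes it below -/
import Mathlib

section
/- Let a and b be positive integers with a ∣ b, let S be a gcd-closed set of distinct positive integers satisfying condition 𝒢, and let x_l, x_m ∈ S with G_S(x_m) = {x_{m₁}, x_{m₂}, x_{m₃}} consisting of exactly three elements; set x_{m_{ij}} := gcd(x_{m_i}, x_{m_j}) for 1 ≤ i < j ≤ 3 and x_{m₄} := gcd(x_{m₁}, x_{m₂}, x_{m₃}). Then the integer x_m^a − x_{m₁}^a − x_{m₂}^a − x_{m₃}^a + x_{m_{12}}^a + x_{m_{13}}^a + x_{m_{23}}^a − x_{m₄}^a divides the integer lcm(x_l, x_m)^b − lcm(x_l, x_{m₁})^b − lcm(x_l, x_{m₂})^b − lcm(x_l, x_{m₃})^b + lcm(x_l, x_{m_{12}})^b + lcm(x_l, x_{m_{13}})^b + lcm(x_l, x_{m_{23}})^b − lcm(x_l, x_{m₄})^b. -/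
open Finset

def gcdClosed (S : Finset ℕ) : Prop := ∀ x ∈ S, ∀ y ∈ S, Nat.gcd x y ∈ S

/-- The set of greatest-type divisors of `x` in `S`. -/
def GTD (S : Finset ℕ) (x : ℕ) : Finset ℕ :=
  S.filter fun d => d < x ∧ d ∣ x ∧ ∀ y ∈ S, d ∣ y → y ∣ x → y = d ∨ y = x

/-- The element `x` satisfies condition 𝒢 with respect to `S`. -/
def condGAt (S : Finset ℕ) (x : ℕ) : Prop :=
  ∀ y₁ ∈ GTD S x, ∀ y₂ ∈ GTD S x, y₁ ≠ y₂ →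
    Nat.lcm y₁ y₂ = x ∧ Nat.gcd y₁ y₂ ∈ GTD S y₁ ∧ Nat.gcd y₁ y₂ ∈ GTD S y₂

/-- The set `S` satisfies condition 𝒢. -/
def condG (S : Finset ℕ) : Prop := ∀ x ∈ S, condGAt S x

/-- `c_{ij}`: the sum of `μ(d)` over positive integers `d` with `d·x_i ∣ x_j` and
`d·x_i ∤ x_t` for every `x_t ∈ S` with `x_t < x_j`. -/
def cMat {n : ℕ} (x : Fin n → ℕ) (i j : Fin n) : ℤ :=
  ∑ d ∈ (x j).divisors.filter
      (fun d => d * x i ∣ x j ∧ ∀ t : Fin n, x t < x j → ¬ d * x i ∣ x t),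
    ArithmeticFunction.moebius d

/-- `α_{ξ_a}(x_k)`: the sum of `(ξ_a * μ)(d)` over divisors `d` of `x_k` with
`d ∤ x_t` for every `x_t ∈ S` with `x_t < x_k`. -/
def alphaXi {n : ℕ} (a : ℕ) (x : Fin n → ℕ) (k : Fin n) : ℤ :=
  ∑ d ∈ (x k).divisors.filter (fun d => ∀ t : Fin n, x t < x k → ¬ d ∣ x t),
    ∑ e ∈ d.divisors, (e : ℤ) ^ a * ArithmeticFunction.moebius (d / e)

/-- `α_{1/ξ_a}(x_k)`: the sum of `((1/ξ_a) * μ)(d)` over divisors `d` of `x_k` with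
`d ∤ x_t` for every `x_t ∈ S` with `x_t < x_k`. -/
def alphaInvXi {n : ℕ} (a : ℕ) (x : Fin n → ℕ) (k : Fin n) : ℚ :=
  ∑ d ∈ (x k).divisors.filter (fun d => ∀ t : Fin n, x t < x k → ¬ d ∣ x t),
    ∑ e ∈ d.divisors, ((e : ℚ) ^ a)⁻¹ * ((ArithmeticFunction.moebius (d / e) : ℤ) : ℚ)

/-- A proper divisor of `x` in `S` divides some greatest-type divisor of `x` in `S`. -/
theorem exists_mem_GTD_dvd {S : Finset ℕ} {g x : ℕ} (hx : 0 < x) (hg : g ∈ S) (hgx : g ∣ x)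
    (hlt : g < x) : ∃ z ∈ GTD S x, g ∣ z := by
  have hne : (S.filter fun d => d < x ∧ d ∣ x ∧ g ∣ d).Nonempty :=
    ⟨g, by simp [hg, hgx, hlt]⟩
  obtain ⟨z, hz, hmax⟩ := Finset.exists_max_image _ id hne
  simp only [Finset.mem_filter, id] at hz hmax
  obtain ⟨hzS, hzlt, hzx, hgz⟩ := hz
  refine ⟨z, ?_, hgz⟩
  simp only [GTD, Finset.mem_filter]
  refine ⟨hzS, hzlt, hzx, fun y hy hzy hyx => ?_⟩
  rcases (Nat.le_of_dvd hx hyx).lt_or_eq with h | h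
  · left
    exact le_antisymm (hmax y ⟨hy, h, hyx, hgz.trans hzy⟩)
      (Nat.le_of_dvd (Nat.pos_of_dvd_of_pos hyx hx) hzy)
  · exact Or.inr h

/-- Under condition 𝒢, a greatest-type divisor `w` of `u` behaves like a coatom of a distributive
lattice: each divisor of `u` in `S` either divides `w` or has least common multiple `u` with `w`. -/
theorem dvd_or_lcm_eq_of_mem_GTD {S : Finset ℕ} (hpos : ∀ u ∈ S, 0 < u) (hG : condG S) {g : ℕ}
    (hg : g ∈ S) {u w : ℕ} (hu : u ∈ S) (hw : w ∈ GTD S u) (hgu : g ∣ u) :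
    g ∣ w ∨ Nat.lcm g w = u := by
  induction u using Nat.strong_induction_on generalizing w with
  | _ u ih =>
    have hw' := hw
    simp only [GTD, Finset.mem_filter] at hw'
    obtain ⟨-, -, hwu, -⟩ := hw'
    rcases (Nat.le_of_dvd (hpos u hu) hgu).lt_or_eq with hlt | rfl
    · obtain ⟨z, hz, hgz⟩ := exists_mem_GTD_dvd (hpos u hu) hg hgu hlt
      by_cases hzw : z = w
      · exact Or.inl (hzw ▸ hgz)
      obtain ⟨h1, h2, -⟩ := hG u hu z hz w hw hzw
      simp only [GTD, Finset.mem_filter] at hz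
      rcases ih z hz.2.1 hz.1 h2 hgz with h | h
      · exact Or.inl (h.trans (Nat.gcd_dvd_right z w))
      · right
        refine Nat.dvd_antisymm (Nat.lcm_dvd hgu hwu) ?_
        rw [← h1]
        refine Nat.lcm_dvd ?_ (Nat.dvd_lcm_right g w)
        rw [← h]
        exact Nat.lcm_dvd (Nat.dvd_lcm_left g w)
          ((Nat.gcd_dvd_right z w).trans (Nat.dvd_lcm_right g w))
    · exact Or.inr (Nat.lcm_eq_left hwu)

theorem dvd_lcm_gcd_gcd_of_dvd_lcm {l y z : ℕ} (hz : 0 < z) (h : z ∣ Nat.lcm l y) :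
    z ∣ Nat.lcm (Nat.gcd z l) (Nat.gcd z y) := by
  have hG : 0 < Nat.gcd (Nat.gcd z l) (Nat.gcd z y) :=
    Nat.gcd_pos_of_pos_left _ (Nat.gcd_pos_of_pos_left _ hz)
  refine Nat.dvd_of_mul_dvd_mul_left hG ?_
  rw [Nat.gcd_mul_lcm]
  have hzl := Nat.gcd_dvd_left (Nat.gcd z l) (Nat.gcd z y)
  have hzy := Nat.gcd_dvd_right (Nat.gcd z l) (Nat.gcd z y)
  set G := Nat.gcd (Nat.gcd z l) (Nat.gcd z y)
  have Gz := hzl.trans (Nat.gcd_dvd_left z l)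
  have Gl := hzl.trans (Nat.gcd_dvd_right z l)
  have Gy := hzy.trans (Nat.gcd_dvd_right z y)
  clear_value G
  rw [← Nat.gcd_mul_right]
  refine Nat.dvd_gcd ?_ ?_ <;> rw [← Nat.gcd_mul_left]
  · exact Nat.dvd_gcd (mul_dvd_mul_right Gz z) (mul_comm G z ▸ mul_dvd_mul_left z Gy)
  · refine Nat.dvd_gcd (mul_dvd_mul_right Gl z) ?_
    rw [← Nat.gcd_mul_lcm l y]
    exact mul_dvd_mul (Nat.dvd_gcd Gl Gy) h

theorem lcm_gcd_eq_of_dvd_lcm {l y z : ℕ} (hz : 0 < z) (h : z ∣ Nat.lcm l y) :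
    Nat.lcm l (Nat.gcd y z) = Nat.lcm l z := by
  refine Nat.dvd_antisymm (Nat.lcm_dvd_lcm_of_dvd_right l (Nat.gcd_dvd_right y z))
    (Nat.lcm_dvd (Nat.dvd_lcm_left _ _) ((dvd_lcm_gcd_gcd_of_dvd_lcm hz h).trans ?_))
  rw [Nat.gcd_comm z y]
  exact Nat.lcm_dvd_lcm_of_dvd_left _ (Nat.gcd_dvd_right z l)

theorem coprime_of_lcm_eq {m p q y z : ℕ} (hm : 0 < m) (hp : m = p * y) (hq : m = q * z)
    (h : Nat.lcm y z = m) : Nat.Coprime p q := by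
  obtain ⟨p', hp'⟩ := Nat.gcd_dvd_left p q
  obtain ⟨q', hq'⟩ := Nat.gcd_dvd_right p q
  have hd : 0 < Nat.gcd p q := by
    rcases Nat.eq_zero_or_pos (Nat.gcd p q) with h0 | h0
    · rw [Nat.gcd_eq_zero_iff] at h0
      simp [h0.1] at hp
      omega
    · exact h0
  rw [Nat.Coprime]
  generalize Nat.gcd p q = d at *
  have e1 : m = d * (p' * y) := by rw [hp, hp', mul_assoc]
  have e2 : m = d * (q' * z) := by rw [hq, hq', mul_assoc]
  have e : p' * y = q' * z := Nat.eq_of_mul_eq_mul_left hd (e1.symm.trans e2)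
  have hpos : 0 < p' * y := Nat.pos_of_ne_zero fun h0 => by simp [h0] at e1; omega
  have hdvd : m ∣ p' * y := h ▸ Nat.lcm_dvd (Dvd.intro_left _ rfl) (e ▸ Dvd.intro_left _ rfl)
  have hle := Nat.le_of_dvd hpos hdvd
  nlinarith

/-- Three divisors of `m` whose pairwise least common multiples all equal `m` are the products of
a common part with two out of three pairwise coprime factors. -/
theorem exists_eq_mul_of_lcm_eq {m y₁ y₂ y₃ : ℕ} (hm : 0 < m) (h12 : Nat.lcm y₁ y₂ = m)
    (h13 : Nat.lcm y₁ y₃ = m) (h23 : Nat.lcm y₂ y₃ = m) :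
    ∃ w p q r : ℕ, Nat.Coprime p q ∧ Nat.Coprime p r ∧ Nat.Coprime q r ∧
      m = w * p * q * r ∧ y₁ = w * q * r ∧ y₂ = w * p * r ∧ y₃ = w * p * q := by
  obtain ⟨p, hp⟩ : y₁ ∣ m := h12 ▸ Nat.dvd_lcm_left y₁ y₂
  obtain ⟨q, hq⟩ : y₂ ∣ m := h12 ▸ Nat.dvd_lcm_right y₁ y₂
  obtain ⟨r, hr⟩ : y₃ ∣ m := h13 ▸ Nat.dvd_lcm_right y₁ y₃
  rw [mul_comm] at hp hq hr
  have cpq := coprime_of_lcm_eq hm hp hq h12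
  have cpr := coprime_of_lcm_eq hm hp hr h13
  have cqr := coprime_of_lcm_eq hm hq hr h23
  obtain ⟨w, hw⟩ : p * q * r ∣ m :=
    (Nat.Coprime.mul_left cpr cqr).mul_dvd_of_dvd_of_dvd
      (cpq.mul_dvd_of_dvd_of_dvd ⟨_, hp⟩ ⟨_, hq⟩) ⟨_, hr⟩
  have hp0 : 0 < p := Nat.pos_of_ne_zero fun h0 => by simp [h0] at hp; omega
  have hq0 : 0 < q := Nat.pos_of_ne_zero fun h0 => by simp [h0] at hq; omega
  have hr0 : 0 < r := Nat.pos_of_ne_zero fun h0 => by simp [h0] at hr; omega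
  refine ⟨w, p, q, r, cpq, cpr, cqr, by rw [hw]; ring, ?_, ?_, ?_⟩
  · exact Nat.eq_of_mul_eq_mul_left hp0 (by rw [← hp, hw]; ring)
  · exact Nat.eq_of_mul_eq_mul_left hq0 (by rw [← hq, hw]; ring)
  · exact Nat.eq_of_mul_eq_mul_left hr0 (by rw [← hr, hw]; ring)


theorem alpha_dvd_lcm_alternating_sum
    (a b : ℕ) (ha : 0 < a) (hb : 0 < b) (hab : a ∣ b)
    (S : Finset ℕ) (hpos : ∀ u ∈ S, 0 < u) (hgcd : gcdClosed S) (hG : condG S)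
    (xl xm y₁ y₂ y₃ : ℕ) (hl : xl ∈ S) (hm : xm ∈ S)
    (hGTD : GTD S xm = {y₁, y₂, y₃}) (hcard : ({y₁, y₂, y₃} : Finset ℕ).card = 3) :
    ((xm : ℤ) ^ a - (y₁ : ℤ) ^ a - (y₂ : ℤ) ^ a - (y₃ : ℤ) ^ a
      + (Nat.gcd y₁ y₂ : ℤ) ^ a + (Nat.gcd y₁ y₃ : ℤ) ^ a + (Nat.gcd y₂ y₃ : ℤ) ^ a
      - (Nat.gcd (Nat.gcd y₁ y₂) y₃ : ℤ) ^ a) ∣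
    ((Nat.lcm xl xm : ℤ) ^ b - (Nat.lcm xl y₁ : ℤ) ^ b - (Nat.lcm xl y₂ : ℤ) ^ b
      - (Nat.lcm xl y₃ : ℤ) ^ b + (Nat.lcm xl (Nat.gcd y₁ y₂) : ℤ) ^ b
      + (Nat.lcm xl (Nat.gcd y₁ y₃) : ℤ) ^ b + (Nat.lcm xl (Nat.gcd y₂ y₃) : ℤ) ^ b
      - (Nat.lcm xl (Nat.gcd (Nat.gcd y₁ y₂) y₃) : ℤ) ^ b) := by
  have hm0 := hpos xm hm
  obtain ⟨n12, n13, n23⟩ : y₁ ≠ y₂ ∧ y₁ ≠ y₃ ∧ y₂ ≠ y₃ := by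
    refine ⟨?_, ?_, ?_⟩ <;> rintro rfl <;>
      simp at hcard <;> exact absurd hcard (ne_of_lt (lt_of_le_of_lt Finset.card_le_two (by norm_num)))
  have m1 : y₁ ∈ GTD S xm := by simp [hGTD]
  have m2 : y₂ ∈ GTD S xm := by simp [hGTD]
  have m3 : y₃ ∈ GTD S xm := by simp [hGTD]
  have h12 := (hG xm hm y₁ m1 y₂ m2 n12).1
  have h13 := (hG xm hm y₁ m1 y₃ m3 n13).1
  have h23 := (hG xm hm y₂ m2 y₃ m3 n23).1
  have d1 : y₁ ∣ xm := h12 ▸ Nat.dvd_lcm_left y₁ y₂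
  have d2 : y₂ ∣ xm := h12 ▸ Nat.dvd_lcm_right y₁ y₂
  have d3 : y₃ ∣ xm := h13 ▸ Nat.dvd_lcm_right y₁ y₃
  have hgS := hgcd xl hl xm hm
  have hgm := Nat.gcd_dvd_right xl xm
  have hgl := Nat.gcd_dvd_left xl xm
  have key : ∀ y, Nat.lcm (Nat.gcd xl xm) y = xm → ∀ z, z ∣ xm →
      Nat.lcm xl (Nat.gcd y z) = Nat.lcm xl z := fun y hy z hz =>
    lcm_gcd_eq_of_dvd_lcm (Nat.pos_of_dvd_of_pos hz hm0) (hz.trans (hy ▸ Nat.lcm_dvd_lcm_of_dvd_left y hgl))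
  rcases dvd_or_lcm_eq_of_mem_GTD hpos hG hgS hm m1 hgm with g1 | g1
  swap
  · have e0 := key y₁ g1 xm dvd_rfl
    rw [Nat.gcd_eq_left d1] at e0
    rw [Nat.gcd_assoc, key y₁ g1 y₂ d2, key y₁ g1 y₃ d3,
      key y₁ g1 _ ((Nat.gcd_dvd_left y₂ y₃).trans d2), e0]
    ring_nf
    exact dvd_zero _
  rcases dvd_or_lcm_eq_of_mem_GTD hpos hG hgS hm m2 hgm with g2 | g2
  swap
  · have e0 := key y₂ g2 xm dvd_rfl
    rw [Nat.gcd_eq_left d2] at e0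
    rw [Nat.gcd_comm y₁ y₂, Nat.gcd_assoc, key y₂ g2 y₁ d1, key y₂ g2 y₃ d3,
      key y₂ g2 _ ((Nat.gcd_dvd_left y₁ y₃).trans d1), e0]
    ring_nf
    exact dvd_zero _
  rcases dvd_or_lcm_eq_of_mem_GTD hpos hG hgS hm m3 hgm with g3 | g3
  swap
  · have e0 := key y₃ g3 xm dvd_rfl
    rw [Nat.gcd_eq_left d3] at e0
    rw [Nat.gcd_comm (Nat.gcd y₁ y₂) y₃, Nat.gcd_comm y₁ y₃, Nat.gcd_comm y₂ y₃,
      key y₃ g3 y₁ d1, key y₃ g3 y₂ d2, key y₃ g3 _ ((Nat.gcd_dvd_left y₁ y₂).trans d1), e0]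
    ring_nf
    exact dvd_zero _
  obtain ⟨k, hk⟩ := hgl
  have hg0 := hpos _ hgS
  have hlcm : ∀ x, x ∣ xm → Nat.gcd xl xm ∣ x → Nat.lcm xl x = k * x := fun x hx hgx => by
    have hgcd_eq : Nat.gcd xl x = Nat.gcd xl xm :=
      Nat.dvd_antisymm (Nat.gcd_dvd_gcd_of_dvd_right xl hx)
        (Nat.dvd_gcd (Nat.gcd_dvd_left xl xm) hgx)
    have hmul := Nat.gcd_mul_lcm xl x
    rw [hgcd_eq] at hmul
    refine Nat.eq_of_mul_eq_mul_left hg0 (hmul.trans ?_)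
    rw [← mul_assoc, ← hk]
  rw [hlcm xm dvd_rfl hgm, hlcm y₁ d1 g1, hlcm y₂ d2 g2, hlcm y₃ d3 g3,
    hlcm _ ((Nat.gcd_dvd_left y₁ y₂).trans d1) (Nat.dvd_gcd g1 g2),
    hlcm _ ((Nat.gcd_dvd_left y₁ y₃).trans d1) (Nat.dvd_gcd g1 g3),
    hlcm _ ((Nat.gcd_dvd_left y₂ y₃).trans d2) (Nat.dvd_gcd g2 g3),
    hlcm _ (((Nat.gcd_dvd_left _ y₃).trans (Nat.gcd_dvd_left y₁ y₂)).trans d1)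
      (Nat.dvd_gcd (Nat.dvd_gcd g1 g2) g3)]
  obtain ⟨w, p, q, r, cpq, cpr, cqr, em, e1, e2, e3⟩ := exists_eq_mul_of_lcm_eq hm0 h12 h13 h23
  have e12 : Nat.gcd y₁ y₂ = w * r := by
    rw [e1, e2, Nat.gcd_mul_right, Nat.gcd_mul_left, cpq.symm.gcd_eq_one, mul_one]
  have e13 : Nat.gcd y₁ y₃ = w * q := by
    rw [e1, e3, mul_right_comm w q r, Nat.gcd_mul_right, Nat.gcd_mul_left, cpr.symm.gcd_eq_one,
      mul_one]
  have e23 : Nat.gcd y₂ y₃ = w * p := by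
    rw [e2, e3, Nat.gcd_mul_left, cqr.symm.gcd_eq_one, mul_one]
  have e123 : Nat.gcd (Nat.gcd y₁ y₂) y₃ = w := by
    rw [e12, e3, mul_assoc, Nat.gcd_mul_left, (Nat.Coprime.mul_left cpr cqr).symm.gcd_eq_one,
      mul_one]
  rw [e123, e12, e13, e23, em, e1, e2, e3]
  have hsub : ∀ t : ℕ, (t : ℤ) ^ a - 1 ∣ (t : ℤ) ^ b - 1 := fun t => by
    obtain ⟨c, rfl⟩ := hab
    simpa [pow_mul] using sub_dvd_pow_sub_pow ((t : ℤ) ^ a) 1 c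
  have hdvd : (w : ℤ) ^ a * ((p : ℤ) ^ a - 1) * ((q : ℤ) ^ a - 1) * ((r : ℤ) ^ a - 1) ∣
      (w : ℤ) ^ b * ((p : ℤ) ^ b - 1) * ((q : ℤ) ^ b - 1) * ((r : ℤ) ^ b - 1) :=
    mul_dvd_mul (mul_dvd_mul (mul_dvd_mul (pow_dvd_pow _ (Nat.le_of_dvd hb hab)) (hsub p))
      (hsub q)) (hsub r)
  have hexp : ∀ n : ℕ, (w : ℤ) ^ n * ((p : ℤ) ^ n - 1) * ((q : ℤ) ^ n - 1) * ((r : ℤ) ^ n - 1) =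
      (w * p * q * r : ℤ) ^ n - (w * q * r : ℤ) ^ n - (w * p * r : ℤ) ^ n - (w * p * q : ℤ) ^ n
        + (w * r : ℤ) ^ n + (w * q : ℤ) ^ n + (w * p : ℤ) ^ n - (w : ℤ) ^ n := fun n => by
    simp only [mul_pow]
    ring
  rw [hexp, hexp] at hdvd
  push_cast
  simp only [mul_pow (k : ℤ), ← mul_sub, ← mul_add]
  exact hdvd.mul_left _
end

section
/- Let a and b be positive integers with a ∣ b, let S be a gcd-closed set of distinct positive integers satisfying condition 𝒢, and let x_l, x_m, x_s ∈ S with x_s ∣ x_m and with G_S(x_m) = {x_{m₁}, x_{m₂}, x_{m₃}} consisting of exactly three elements; set x_{m_{ij}} := gcd(x_{m_i}, x_{m_j}) for 1 ≤ i < j ≤ 3 and x_{m₄} := gcd(x_{m₁}, x_{m₂}, x_{m₃}). Then the rational number (lcm(x_l, x_m)^b/x_m^a − lcm(x_l, x_{m₁})^b/x_{m₁}^a − lcm(x_l, x_{m₂})^b/x_{m₂}^a − lcm(x_l, x_{m₃})^b/x_{m₃}^a + lcm(x_l, x_{m_{12}})^b/x_{m_{12}}^a + lcm(x_l, x_{m_{13}})^b/x_{m_{13}}^a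 + lcm(x_l, x_{m_{23}})^b/x_{m_{23}}^a − lcm(x_l, x_{m₄})^b/x_{m₄}^a) divided by x_s^a·(x_m^{−a} − x_{m₁}^{−a} − x_{m₂}^{−a} − x_{m₃}^{−a} + x_{m_{12}}^{−a} + x_{m_{13}}^{−a} + x_{m_{23}}^{−a} − x_{m₄}^{−a}) is an integer. -/
open Finset

theorem lcm_gcd_distrib {k m n : ℕ} (hk : k ≠ 0) (hm : m ≠ 0) (hn : n ≠ 0) :
    k.lcm (m.gcd n) = (k.lcm m).gcd (k.lcm n) := by
  refine Nat.eq_of_factorization_eq (Nat.lcm_ne_zero hk (Nat.gcd_ne_zero_left hm))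
    (Nat.gcd_ne_zero_left (Nat.lcm_ne_zero hk hm)) fun p => ?_
  rw [Nat.factorization_lcm hk (Nat.gcd_ne_zero_left hm), Nat.factorization_gcd hm hn,
    Nat.factorization_gcd (Nat.lcm_ne_zero hk hm) (Nat.lcm_ne_zero hk hn),
    Nat.factorization_lcm hk hm, Nat.factorization_lcm hk hn]
  simp only [Finsupp.sup_apply, Finsupp.inf_apply]
  exact sup_inf_left ..

theorem mem_GTD {S : Finset ℕ} {x d : ℕ} :
    d ∈ GTD S x ↔ d ∈ S ∧ d < x ∧ d ∣ x ∧ ∀ y ∈ S, d ∣ y → y ∣ x → y = d ∨ y = x := by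
  simp [GTD]

theorem exists_mem_GTD_of_dvd {S : Finset ℕ} {x u : ℕ} (hx : 0 < x) (hu : u ∈ S) (hux : u ∣ x)
    (hne : u ≠ x) : ∃ y ∈ GTD S x, u ∣ y := by
  obtain ⟨y, hy, hmax⟩ := (S.filter fun d => u ∣ d ∧ d ∣ x ∧ d < x).exists_max_image id
    ⟨u, by simpa [hu, hux] using lt_of_le_of_ne (Nat.le_of_dvd hx hux) hne⟩
  simp only [Finset.mem_filter, id] at hy hmax
  obtain ⟨hyS, huy, hyx, hlt⟩ := hy
  refine ⟨y, mem_GTD.2 ⟨hyS, hlt, hyx, fun z hz hyz hzx => ?_⟩, huy⟩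
  by_cases h : z = x
  · exact Or.inr h
  · have hzlt := lt_of_le_of_ne (Nat.le_of_dvd hx hzx) h
    have h1 := hmax z ⟨hz, huy.trans hyz, hzx, hzlt⟩
    exact Or.inl (le_antisymm h1 (Nat.le_of_dvd (Nat.pos_of_dvd_of_pos hzx hx) hyz))

/-- Under condition 𝒢, a divisor of `x` in `S` either divides a given greatest-type divisor
of `x`, or has least common multiple `x` with it. -/
theorem dvd_or_lcm_eq {S : Finset ℕ} (hpos : ∀ u ∈ S, 0 < u) (hG : condG S) {x : ℕ} (hx : x ∈ S)
    {y u : ℕ} (hy : y ∈ GTD S x) (hu : u ∈ S) (hux : u ∣ x) : u ∣ y ∨ u.lcm y = x := by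
  induction x using Nat.strong_induction_on generalizing y with
  | _ x ih =>
    have hyx := (mem_GTD.1 hy).2.2.1
    by_cases hne : u = x
    · exact Or.inr (hne ▸ Nat.lcm_eq_left (hne ▸ hyx))
    obtain ⟨y', hy', huy'⟩ := exists_mem_GTD_of_dvd (hpos x hx) hu hux hne
    by_cases hyy : y = y'
    · exact Or.inl (hyy ▸ huy')
    obtain ⟨hlcm, -, hg⟩ := hG x hx y hy y' hy' hyy
    have hm' := mem_GTD.1 hy'
    rcases ih y' hm'.2.1 hm'.1 hg huy' with h | h
    · exact Or.inl (h.trans (Nat.gcd_dvd_left _ _))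
    · refine Or.inr (Nat.dvd_antisymm (Nat.lcm_dvd hux hyx) ?_)
      have : y' ∣ u.lcm y := h ▸ Nat.lcm_dvd_lcm_of_dvd_right u (Nat.gcd_dvd_left _ _)
      exact hlcm ▸ Nat.lcm_dvd (Nat.dvd_lcm_right _ _) this

theorem gcd_mul_mul_eq_of_lcm_eq {X c₁ c₂ q₁ q₂ : ℕ} (hX : 0 < X) (h₁ : c₁ * q₁ = X)
    (h₂ : c₂ * q₂ = X) (h : c₁.lcm c₂ = X) : c₁.gcd c₂ * (q₁ * q₂) = X := by
  have h' := Nat.gcd_mul_lcm c₁ c₂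
  rw [h] at h'
  refine Nat.eq_of_mul_eq_mul_right hX ?_
  calc c₁.gcd c₂ * (q₁ * q₂) * X = c₁.gcd c₂ * X * (q₁ * q₂) := by ring
    _ = (c₁ * q₁) * (c₂ * q₂) := by rw [h']; ring
    _ = X * X := by rw [h₁, h₂]

theorem gcd_gcd_mul_eq_of_lcm_eq {X c₁ c₂ c₃ q₁ q₂ q₃ : ℕ} (hX : 0 < X) (h₁ : c₁ * q₁ = X)
    (h₂ : c₂ * q₂ = X) (h₃ : c₃ * q₃ = X) (h₁₂ : c₁.lcm c₂ = X) (h₁₃ : c₁.lcm c₃ = X)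
    (h₂₃ : c₂.lcm c₃ = X) : (c₁.gcd c₂).gcd c₃ * (q₁ * q₂ * q₃) = X := by
  have hne : ∀ {c q : ℕ}, c * q = X → c ≠ 0 := by
    rintro c q h rfl
    simp at h
    omega
  refine gcd_mul_mul_eq_of_lcm_eq hX (gcd_mul_mul_eq_of_lcm_eq hX h₁ h₂ h₁₂) h₃ ?_
  rw [Nat.lcm_comm, lcm_gcd_distrib (hne h₃) (hne h₁) (hne h₂), Nat.lcm_comm, h₁₃,
    Nat.lcm_comm, h₂₃, Nat.gcd_self]

theorem exists_lcm_mul_eq {l x y p : ℕ} (hl : 0 < l) (hp : y * p = x)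
    (h : l.gcd x ∣ y ∨ (l.gcd x).lcm y = x) :
    ∃ q, l.lcm y * q = l.lcm x ∧ (q = 1 ∨ q = p) := by
  have hyx : y ∣ x := ⟨p, hp.symm⟩
  rcases h with h | h
  · refine ⟨p, ?_, Or.inr rfl⟩
    have hg : l.gcd y = l.gcd x :=
      Nat.dvd_antisymm (Nat.gcd_dvd_gcd_of_dvd_right l hyx)
        (Nat.dvd_gcd (Nat.gcd_dvd_left _ _) h)
    refine Nat.eq_of_mul_eq_mul_left (Nat.gcd_pos_of_pos_left x hl) ?_
    rw [Nat.gcd_mul_lcm, ← mul_assoc, ← hg, Nat.gcd_mul_lcm, mul_assoc, hp]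
  · refine ⟨1, ?_, Or.inl rfl⟩
    rw [mul_one]
    refine Nat.dvd_antisymm (Nat.lcm_dvd_lcm_of_dvd_right l hyx)
      (Nat.lcm_dvd (Nat.dvd_lcm_left _ _) ?_)
    conv_lhs => rw [← h]
    exact Nat.lcm_dvd_lcm_of_dvd_left y (Nat.gcd_dvd_left _ _)

theorem exists_int_factor {a k p q : ℕ} (hp : 0 < p) (hq : q = 1 ∨ q = p) :
    ∃ z : ℤ, 1 - (p : ℚ) ^ a / (q : ℚ) ^ (a + a * k) =
      z / (p : ℚ) ^ (a * k) * (1 - (p : ℚ) ^ a) := by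
  have hp' : (p : ℚ) ≠ 0 := by positivity
  rcases hq with rfl | rfl
  · refine ⟨p ^ (a * k), ?_⟩
    push_cast
    rw [div_self (pow_ne_zero _ hp')]
    simp
  · refine ⟨-∑ i ∈ Finset.range k, ((q : ℤ) ^ a) ^ i, ?_⟩
    have h := geom_sum_mul ((q : ℚ) ^ a) k
    rw [← pow_mul] at h
    push_cast
    rw [pow_add]
    field_simp
    linear_combination -h

theorem div_pow_div_pow_eq {a b L X A Y Q P : ℕ} (hL : 0 < L) (hX : 0 < X) (hA : A * Q = L)
    (hY : Y * P = X) :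
    (A : ℚ) ^ b / (Y : ℚ) ^ a = (L : ℚ) ^ b / (X : ℚ) ^ a * ((P : ℚ) ^ a / (Q : ℚ) ^ b) := by
  subst hA hY
  have := Nat.pos_of_mul_pos_left hL
  have := Nat.pos_of_mul_pos_right hL
  have := Nat.pos_of_mul_pos_left hX
  have := Nat.pos_of_mul_pos_right hX
  push_cast
  rw [mul_pow, mul_pow]
  field_simp

theorem zpow_neg_eq_div {a X Y P : ℕ} (hX : 0 < X) (hY : Y * P = X) :
    (Y : ℚ) ^ (-(a : ℤ)) = (P : ℚ) ^ a / (X : ℚ) ^ a := by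
  subst hY
  have := Nat.pos_of_mul_pos_left hX
  have := Nat.pos_of_mul_pos_right hX
  rw [zpow_neg, zpow_natCast]
  push_cast
  rw [mul_pow]
  field_simp

theorem h_function_is_integer
    (a b : ℕ) (ha : 0 < a) (hb : 0 < b) (hab : a ∣ b)
    (S : Finset ℕ) (hpos : ∀ u ∈ S, 0 < u) (hgcd : gcdClosed S) (hG : condG S)
    (xl xm xs y₁ y₂ y₃ : ℕ) (hl : xl ∈ S) (hm : xm ∈ S) (hs : xs ∈ S) (hsd : xs ∣ xm)
    (hGTD : GTD S xm = {y₁, y₂, y₃}) (hcard : ({y₁, y₂, y₃} : Finset ℕ).card = 3) :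
    ∃ z : ℤ,
      ((Nat.lcm xl xm : ℚ) ^ b / (xm : ℚ) ^ a
        - (Nat.lcm xl y₁ : ℚ) ^ b / (y₁ : ℚ) ^ a
        - (Nat.lcm xl y₂ : ℚ) ^ b / (y₂ : ℚ) ^ a
        - (Nat.lcm xl y₃ : ℚ) ^ b / (y₃ : ℚ) ^ a
        + (Nat.lcm xl (Nat.gcd y₁ y₂) : ℚ) ^ b / (Nat.gcd y₁ y₂ : ℚ) ^ a
        + (Nat.lcm xl (Nat.gcd y₁ y₃) : ℚ) ^ b / (Nat.gcd y₁ y₃ : ℚ) ^ a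
        + (Nat.lcm xl (Nat.gcd y₂ y₃) : ℚ) ^ b / (Nat.gcd y₂ y₃ : ℚ) ^ a
        - (Nat.lcm xl (Nat.gcd (Nat.gcd y₁ y₂) y₃) : ℚ) ^ b
            / (Nat.gcd (Nat.gcd y₁ y₂) y₃ : ℚ) ^ a) /
      ((xs : ℚ) ^ a *
        ((xm : ℚ) ^ (-(a : ℤ)) - (y₁ : ℚ) ^ (-(a : ℤ)) - (y₂ : ℚ) ^ (-(a : ℤ))
          - (y₃ : ℚ) ^ (-(a : ℤ)) + (Nat.gcd y₁ y₂ : ℚ) ^ (-(a : ℤ))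
          + (Nat.gcd y₁ y₃ : ℚ) ^ (-(a : ℤ)) + (Nat.gcd y₂ y₃ : ℚ) ^ (-(a : ℤ))
          - (Nat.gcd (Nat.gcd y₁ y₂) y₃ : ℚ) ^ (-(a : ℤ)))) = (z : ℚ) := by
  have hne : y₁ ≠ y₂ ∧ y₁ ≠ y₃ ∧ y₂ ≠ y₃ := by
    refine ⟨?_, ?_, ?_⟩ <;> rintro rfl <;> revert hcard <;>
      simp <;> exact ne_of_lt (Nat.lt_succ_of_le Finset.card_le_two)
  obtain ⟨h12, h13, h23⟩ := hne
  have hm1 : y₁ ∈ GTD S xm := by simp [hGTD]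
  have hm2 : y₂ ∈ GTD S xm := by simp [hGTD]
  have hm3 : y₃ ∈ GTD S xm := by simp [hGTD]
  have hx := hpos xm hm
  have hl0 := hpos xl hl
  have quot : ∀ y ∈ GTD S xm, ∃ p q, 1 < p ∧ y * p = xm ∧
      xl.lcm y * q = xl.lcm xm ∧ (q = 1 ∨ q = p) := by
    intro y hy
    obtain ⟨-, hlt, ⟨p, hp⟩, -⟩ := mem_GTD.1 hy
    obtain ⟨q, hq⟩ := exists_lcm_mul_eq hl0 hp.symm
      (dvd_or_lcm_eq hpos hG hm hy (hgcd _ hl _ hm) (Nat.gcd_dvd_right _ _))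
    refine ⟨p, q, ?_, hp.symm, hq⟩
    by_contra! hle
    interval_cases p <;> omega
  obtain ⟨p₁, q₁, hp1, hy1, hA1, hq1⟩ := quot y₁ hm1
  obtain ⟨p₂, q₂, hp2, hy2, hA2, hq2⟩ := quot y₂ hm2
  obtain ⟨p₃, q₃, hp3, hy3, hA3, hq3⟩ := quot y₃ hm3
  have l12 := (hG xm hm _ hm1 _ hm2 h12).1
  have l13 := (hG xm hm _ hm1 _ hm3 h13).1
  have l23 := (hG xm hm _ hm2 _ hm3 h23).1
  have hL : 0 < xl.lcm xm := Nat.lcm_pos hl0 hx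
  have lcm_lcm : ∀ {y z}, y.lcm z = xm → (xl.lcm y).lcm (xl.lcm z) = xl.lcm xm := by
    rintro y z rfl
    rw [Nat.lcm_comm xl y, Nat.lcm_assoc, Nat.lcm_lcm_self_right_left, ← Nat.lcm_assoc,
      Nat.lcm_comm y xl, Nat.lcm_assoc]
  have hy1' := (mem_GTD.1 hm1).1 |> hpos _ |>.ne'
  have hy2' := (mem_GTD.1 hm2).1 |> hpos _ |>.ne'
  have hy3' := (mem_GTD.1 hm3).1 |> hpos _ |>.ne'
  have hA12 := gcd_mul_mul_eq_of_lcm_eq hL hA1 hA2 (lcm_lcm l12)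
  have hA13 := gcd_mul_mul_eq_of_lcm_eq hL hA1 hA3 (lcm_lcm l13)
  have hA23 := gcd_mul_mul_eq_of_lcm_eq hL hA2 hA3 (lcm_lcm l23)
  have hA4 := gcd_gcd_mul_eq_of_lcm_eq hL hA1 hA2 hA3 (lcm_lcm l12) (lcm_lcm l13) (lcm_lcm l23)
  rw [← lcm_gcd_distrib hl0.ne' hy1' hy2'] at hA12 hA4
  rw [← lcm_gcd_distrib hl0.ne' hy1' hy3'] at hA13
  rw [← lcm_gcd_distrib hl0.ne' hy2' hy3'] at hA23
  rw [← lcm_gcd_distrib hl0.ne' (Nat.gcd_ne_zero_left hy1') hy3'] at hA4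
  have hy12 := gcd_mul_mul_eq_of_lcm_eq hx hy1 hy2 l12
  have hy13 := gcd_mul_mul_eq_of_lcm_eq hx hy1 hy3 l13
  have hy23 := gcd_mul_mul_eq_of_lcm_eq hx hy2 hy3 l23
  have hy4 := gcd_gcd_mul_eq_of_lcm_eq hx hy1 hy2 hy3 l12 l13 l23
  obtain ⟨k, rfl⟩ : ∃ k, b = a + a * k := by
    obtain ⟨c, rfl⟩ := hab
    obtain ⟨k, rfl⟩ := Nat.exists_eq_succ_of_ne_zero (Nat.pos_of_mul_pos_left hb).ne'
    exact ⟨k, by rw [Nat.mul_succ, add_comm]⟩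
  obtain ⟨z₁, hz1⟩ := exists_int_factor (a := a) (k := k) (by omega : 0 < p₁) hq1
  obtain ⟨z₂, hz2⟩ := exists_int_factor (a := a) (k := k) (by omega : 0 < p₂) hq2
  obtain ⟨z₃, hz3⟩ := exists_int_factor (a := a) (k := k) (by omega : 0 < p₃) hq3
  obtain ⟨c, hc⟩ : xs ∣ xl.lcm xm := hsd.trans (Nat.dvd_lcm_right _ _)
  obtain ⟨d, hd⟩ : p₁ * p₂ * p₃ ∣ xl.lcm xm :=
    (Dvd.intro_left _ hy4).trans (Nat.dvd_lcm_right _ _)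
  have hcQ : (xl.lcm xm : ℚ) = xs * c := by exact_mod_cast hc
  have hdQ : (xl.lcm xm : ℚ) = p₁ * p₂ * p₃ * d := by exact_mod_cast hd
  refine ⟨c ^ a * d ^ (a * k) * (z₁ * z₂ * z₃), ?_⟩
  rw [div_pow_div_pow_eq hL hx hA1 hy1, div_pow_div_pow_eq hL hx hA2 hy2,
    div_pow_div_pow_eq hL hx hA3 hy3, div_pow_div_pow_eq hL hx hA12 hy12,
    div_pow_div_pow_eq hL hx hA13 hy13, div_pow_div_pow_eq hL hx hA23 hy23,
    div_pow_div_pow_eq hL hx hA4 hy4, zpow_neg_eq_div hx (mul_one xm), zpow_neg_eq_div hx hy1,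
    zpow_neg_eq_div hx hy2, zpow_neg_eq_div hx hy3, zpow_neg_eq_div hx hy12,
    zpow_neg_eq_div hx hy13, zpow_neg_eq_div hx hy23, zpow_neg_eq_div hx hy4]
  have one_sub_ne : ∀ {p : ℕ}, 1 < p → 1 - (p : ℚ) ^ a ≠ 0 := fun {p} hp =>
    (sub_neg.2 (one_lt_pow₀ (by exact_mod_cast hp) ha.ne')).ne
  have e1 := one_sub_ne hp1
  have e2 := one_sub_ne hp2
  have e3 := one_sub_ne hp3
  have hxs : 0 < xs := hpos xs hs
  have hsQ : (xs : ℚ) ^ a ≠ 0 := by positivity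
  have hxQ : (xm : ℚ) ^ a ≠ 0 := by positivity
  have hP : ((p₁ : ℚ) * p₂ * p₃) ^ (a * k) ≠ 0 := by positivity
  have hLb : (xl.lcm xm : ℚ) ^ (a + a * k) =
      ((xs : ℚ) ^ a * c ^ a) * (((p₁ : ℚ) * p₂ * p₃) ^ (a * k) * d ^ (a * k)) := by
    rw [pow_add, ← mul_pow, ← mul_pow, ← hcQ, ← hdQ]
  have hprod : (1 - (p₁ : ℚ) ^ a / (q₁ : ℚ) ^ (a + a * k)) *
      (1 - (p₂ : ℚ) ^ a / (q₂ : ℚ) ^ (a + a * k)) *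
      (1 - (p₃ : ℚ) ^ a / (q₃ : ℚ) ^ (a + a * k)) =
      z₁ * z₂ * z₃ / ((p₁ : ℚ) * p₂ * p₃) ^ (a * k) *
        ((1 - (p₁ : ℚ) ^ a) * (1 - (p₂ : ℚ) ^ a) * (1 - (p₃ : ℚ) ^ a)) := by
    rw [hz1, hz2, hz3, mul_pow, mul_pow]
    simp only [div_eq_mul_inv, mul_inv]
    ring
  push_cast
  trans ((xl.lcm xm : ℚ) ^ (a + a * k) / (xm : ℚ) ^ a *
      ((1 - (p₁ : ℚ) ^ a / (q₁ : ℚ) ^ (a + a * k)) *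
      (1 - (p₂ : ℚ) ^ a / (q₂ : ℚ) ^ (a + a * k)) *
      (1 - (p₃ : ℚ) ^ a / (q₃ : ℚ) ^ (a + a * k)))) / ((xs : ℚ) ^ a / (xm : ℚ) ^ a *
        ((1 - (p₁ : ℚ) ^ a) * (1 - (p₂ : ℚ) ^ a) * (1 - (p₃ : ℚ) ^ a)))
  · congr 1
    · simp only [mul_pow, div_eq_mul_inv, mul_inv]
      ring
    · simp only [one_pow, mul_pow, div_eq_mul_inv]
      ring
  · rw [hprod, hLb]
    generalize ((p₁ : ℚ) * p₂ * p₃) ^ (a * k) = P at *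
    generalize 1 - (p₁ : ℚ) ^ a = f₁ at *
    generalize 1 - (p₂ : ℚ) ^ a = f₂ at *
    generalize 1 - (p₃ : ℚ) ^ a = f₃ at *
    field_simp
end
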